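/- Let N > 0, let σ₁, …, σ_N be real numbers, let Λ = diag(σ₁, …, σ_N) ∈ ℝ^{N×N}, and let 𝒥 = (𝒥¹, …, 𝒥^N)ᵀ ∈ ℝ^N. Then the (N+1)×(N+1) real block matrix Q = [[Λ, −𝒥],[𝒥ᵀ, 0]] has at most one pair of complex-conjugate non-real eigenvalues; equivalently, the multiset of roots (counted with multiplicity) of the characteristic polynomial of Q over ℂ contains at most 2 elements with nonzero imaginary part. -/

import Mathlib

open scoped Classical

namespace NonrealAux
open Polynomial

lemma sub_ne {z : ℂ} (hz : z.im ≠ 0) (s : ℝ) : z - (s : ℂ) ≠ 0 := by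
  intro h
  apply hz
  have := congrArg Complex.im h
  simpa using this

lemma norm_sum {n : ℕ} (σ J : Fin n → ℝ) {z : ℂ} (hz : z.im ≠ 0)
    (h : z + ∑ i, (J i : ℂ) ^ 2 / (z - σ i) = 0) :
    ∑ i, Complex.normSq ((J i : ℂ) / (z - σ i)) = 1 := by
  have h1 := congrArg Complex.im h
  simp only [Complex.add_im, Complex.im_sum, Complex.zero_im] at h1
  have h2 : ∀ i, ((J i : ℂ) ^ 2 / (z - σ i)).im
      = - z.im * Complex.normSq ((J i : ℂ) / (z - σ i)) := by
    intro i
    rw [← Complex.ofReal_pow, Complex.div_im, map_div₀, Complex.normSq_ofReal,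
      Complex.ofReal_re, Complex.ofReal_im, Complex.sub_im, Complex.ofReal_im]
    ring
  simp only [h2, ← Finset.mul_sum] at h1
  have : z.im * (1 - ∑ i, Complex.normSq ((J i : ℂ) / (z - σ i))) = 0 := by linarith
  rcases mul_eq_zero.1 this with h | h
  · exact absurd h hz
  · linarith

lemma key {n : ℕ} (σ J : Fin n → ℝ) {z w : ℂ} (hz : z.im ≠ 0) (hw : w.im ≠ 0)
    (h : z + ∑ i, (J i : ℂ) ^ 2 / (z - σ i) = 0)
    (h' : w + ∑ i, (J i : ℂ) ^ 2 / (w - σ i) = 0)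
    (hzw : ∑ i, ((J i : ℂ) / (z - σ i)) * ((J i : ℂ) / (w - σ i)) = 1) :
    w = (starRingEnd ℂ) z := by
  have a := norm_sum σ J hz h
  have b := norm_sum σ J hw h'
  have c := congrArg Complex.re hzw
  rw [Complex.re_sum, Complex.one_re] at c
  have d : ∑ i, Complex.normSq ((J i : ℂ) / (w - σ i) - (starRingEnd ℂ) ((J i : ℂ) / (z - σ i))) = 0 := by
    have : ∀ i, Complex.normSq ((J i : ℂ) / (w - σ i) - (starRingEnd ℂ) ((J i : ℂ) / (z - σ i)))
      = Complex.normSq ((J i : ℂ) / (w - σ i)) + Complex.normSq ((J i : ℂ) / (z - σ i))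
        - 2 * (((J i : ℂ) / (z - σ i)) * ((J i : ℂ) / (w - σ i))).re := by
      intro i
      rw [Complex.normSq_sub, Complex.normSq_conj, Complex.conj_conj, mul_comm ((J i : ℂ) / (w - σ i))]
    simp only [this, Finset.sum_sub_distrib, Finset.sum_add_distrib, ← Finset.mul_sum, a, b, c]
    norm_num
  rw [Finset.sum_eq_zero_iff_of_nonneg (fun i _ => Complex.normSq_nonneg _)] at d
  have ⟨i, hi⟩ : ∃ i, J i ≠ 0 := by
    by_contra! hJ
    simp [hJ] at a
  have e := d i (Finset.mem_univ i)
  rw [Complex.normSq_eq_zero, map_div₀, map_sub, Complex.conj_ofReal, Complex.conj_ofReal] at e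
  have hi' : (J i : ℂ) ≠ 0 := by exact_mod_cast hi
  have hz' : ((starRingEnd ℂ) z).im ≠ 0 := by simpa using hz
  have h1 := sub_ne hw (σ i)
  have h2 := sub_ne hz' (σ i)
  have e2 := sub_eq_zero.1 e
  rw [div_eq_div_iff h1 h2] at e2
  have := mul_left_cancel₀ hi' e2
  linear_combination -this

lemma eval_charpoly {n : ℕ} (σ J : Fin n → ℝ) {z : ℂ} (hz : z.im ≠ 0) :
    (((Matrix.fromBlocks (Matrix.diagonal σ)
      (Matrix.of fun i (_ : Unit) => -J i)
      (Matrix.of fun (_ : Unit) j => J j) 0 : Matrix (Fin n ⊕ Unit) (Fin n ⊕ Unit) ℝ).map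
        Complex.ofReal).charpoly).eval z
      = (∏ i, (z - σ i)) * (z + ∑ i, (J i : ℂ) ^ 2 / (z - σ i)) := by
  rw [Matrix.eval_charpoly]
  have : (Matrix.scalar (Fin n ⊕ Unit) z - (Matrix.fromBlocks (Matrix.diagonal σ)
      (Matrix.of fun i (_ : Unit) => -J i)
      (Matrix.of fun (_ : Unit) j => J j) 0 : Matrix (Fin n ⊕ Unit) (Fin n ⊕ Unit) ℝ).map
        Complex.ofReal) = Matrix.fromBlocks (Matrix.diagonal fun i => z - σ i)
          (Matrix.of fun i (_ : Unit) => (J i : ℂ)) (Matrix.of fun (_ : Unit) j => -(J j : ℂ))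
          (Matrix.of fun _ _ => z) := by
    ext i j
    rcases i with i | i <;> rcases j with j | j
    · by_cases hij : i = j
      · subst hij; simp
      · simp [hij]
    · simp
    · simp
    · simp
  rw [this]
  have hd : ∀ i, z - (σ i : ℂ) ≠ 0 := fun i => sub_ne hz _
  letI : Invertible (Matrix.diagonal fun i => z - (σ i : ℂ)) :=
    ⟨Matrix.diagonal fun i => (z - (σ i : ℂ))⁻¹,
      by rw [Matrix.diagonal_mul_diagonal]; simp [hd],
      by rw [Matrix.diagonal_mul_diagonal]; simp [hd]⟩
  have hinv : ⅟(Matrix.diagonal fun i => z - (σ i : ℂ))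
    = Matrix.diagonal fun i => (z - (σ i : ℂ))⁻¹ := rfl
  rw [Matrix.det_fromBlocks₁₁, Matrix.det_diagonal, hinv, Matrix.det_unique]
  congr 1
  rw [Matrix.sub_apply, Matrix.mul_apply]
  simp only [Matrix.mul_diagonal, Matrix.of_apply]
  rw [sub_eq_add_neg, ← Finset.sum_neg_distrib]
  congr 1
  refine Finset.sum_congr rfl fun i _ => ?_
  rw [div_eq_mul_inv]; ring

/-- The quotient of the characteristic polynomial by `X - z`. -/
noncomputable def q {n : ℕ} (σ J : Fin n → ℝ) (z : ℂ) : ℂ[X] :=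
  ∏ i, (X - C (σ i : ℂ)) -
    ∑ i, C ((J i : ℂ) ^ 2 / (z - σ i)) * ∏ j ∈ Finset.univ.erase i, (X - C (σ j : ℂ))

lemma eval_q {n : ℕ} (σ J : Fin n → ℝ) (z : ℂ) {w : ℂ} (hw : w.im ≠ 0) :
    (q σ J z).eval w = (∏ i, (w - σ i)) *
      (1 - ∑ i, ((J i : ℂ) / (z - σ i)) * ((J i : ℂ) / (w - σ i))) := by
  simp only [q, eval_sub, eval_prod, eval_finsetSum, eval_mul, eval_X, eval_C]
  rw [mul_sub, mul_one, Finset.mul_sum]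
  congr 1
  refine Finset.sum_congr rfl fun i _ => ?_
  rw [← Finset.mul_prod_erase Finset.univ _ (Finset.mem_univ i)]
  have := sub_ne hw (σ i)
  field_simp

lemma infinite_nonreal : Set.Infinite {w : ℂ | w.im ≠ 0} := by
  refine Set.infinite_of_injective_forall_mem (f := fun n : ℕ => (⟨n, 1⟩ : ℂ)) ?_ ?_
  · intro a b h
    simpa using congrArg Complex.re h
  · intro a; simp

end NonrealAux

/-- The block matrix `Q = [[Λ, −𝒥],[𝒥ᵀ, 0]]`, with `Λ = diag(σ₁,…,σ_N)`, has at most one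
pair of complex-conjugate non-real eigenvalues: the multiset of roots (with multiplicity)
of its characteristic polynomial over `ℂ` has at most 2 elements with nonzero
imaginary part. -/
theorem at_most_one_pair_of_nonreal_eigenvalues
    (N : ℕ) (hN : 0 < N) (σ 𝒥 : Fin N → ℝ)
    (Q : Matrix (Fin N ⊕ Unit) (Fin N ⊕ Unit) ℝ)
    (hQ : Q = Matrix.fromBlocks (Matrix.diagonal σ)
      (Matrix.of fun i (_ : Unit) => -𝒥 i)
      (Matrix.of fun (_ : Unit) j => 𝒥 j) 0) :
    Multiset.card
      (((Q.map (Complex.ofReal)).charpoly.roots).filter (fun z => z.im ≠ 0)) ≤ 2 := by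
  subst hQ
  set p := ((Matrix.fromBlocks (Matrix.diagonal σ)
      (Matrix.of fun i (_ : Unit) => -𝒥 i)
      (Matrix.of fun (_ : Unit) j => 𝒥 j) 0 : Matrix (Fin N ⊕ Unit) (Fin N ⊕ Unit) ℝ).map
        Complex.ofReal).charpoly with hp
  have hp0 : p ≠ 0 := (Matrix.charpoly_monic _).ne_zero
  have hev : ∀ z : ℂ, z.im ≠ 0 → p.eval z
      = (∏ i, (z - σ i)) * (z + ∑ i, (𝒥 i : ℂ) ^ 2 / (z - σ i)) :=
    fun z hz => NonrealAux.eval_charpoly σ 𝒥 hz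
  have hprod : ∀ z : ℂ, z.im ≠ 0 → (∏ i, (z - (σ i : ℂ))) ≠ 0 := fun z hz =>
    Finset.prod_ne_zero_iff.2 fun i _ => NonrealAux.sub_ne hz _
  have hroot : ∀ z : ℂ, z.im ≠ 0 → z ∈ p.roots →
      z + ∑ i, (𝒥 i : ℂ) ^ 2 / (z - σ i) = 0 := by
    intro z hz h
    have h1 := (Polynomial.mem_roots hp0).1 h
    rw [Polynomial.IsRoot.def, hev z hz] at h1
    exact (mul_eq_zero.1 h1).resolve_left (hprod z hz)
  have hpair : ∀ z w : ℂ, z.im ≠ 0 → w.im ≠ 0 → ({z, w} : Multiset ℂ) ≤ p.roots →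
      w = (starRingEnd ℂ) z := by
    intro z w hz hw hle
    have hzr := hroot z hz (Multiset.mem_of_le hle (by simp))
    have hwr := hroot w hw (Multiset.mem_of_le hle (by simp))
    have hfac : p = (Polynomial.X - Polynomial.C z) * NonrealAux.q σ 𝒥 z := by
      refine Polynomial.eq_of_infinite_eval_eq _ _ (NonrealAux.infinite_nonreal.mono ?_)
      intro v hv
      have hv' : v.im ≠ 0 := hv
      show p.eval v = _
      rw [Polynomial.eval_mul, NonrealAux.eval_q σ 𝒥 z hv', hev v hv', Polynomial.eval_sub,
        Polynomial.eval_X, Polynomial.eval_C, mul_left_comm]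
      congr 1
      have : ∀ i, (v - z) * (((𝒥 i : ℂ) / (z - σ i)) * ((𝒥 i : ℂ) / (v - σ i)))
          = (𝒥 i : ℂ) ^ 2 / (z - σ i) - (𝒥 i : ℂ) ^ 2 / (v - σ i) := by
        intro i
        have h1 := NonrealAux.sub_ne hv' (σ i)
        have h2 := NonrealAux.sub_ne hz (σ i)
        field_simp
        ring
      rw [mul_sub, mul_one, Finset.mul_sum]
      simp only [this, Finset.sum_sub_distrib]
      linear_combination hzr
    have hq0 : (Polynomial.X - Polynomial.C z) * NonrealAux.q σ 𝒥 z ≠ 0 := hfac ▸ hp0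
    rw [hfac, Polynomial.roots_mul hq0, Polynomial.roots_X_sub_C, Multiset.singleton_add] at hle
    have hle2 : ({w} : Multiset ℂ) ≤ (NonrealAux.q σ 𝒥 z).roots :=
      (Multiset.cons_le_cons_iff z).1 hle
    have hwq := (Polynomial.mem_roots (right_ne_zero_of_mul hq0)).1
      (Multiset.singleton_le.1 hle2)
    rw [Polynomial.IsRoot.def, NonrealAux.eval_q σ 𝒥 z hw] at hwq
    have h1 := (mul_eq_zero.1 hwq).resolve_left (hprod w hw)
    exact NonrealAux.key σ 𝒥 hz hw hzr hwr (sub_eq_zero.1 h1).symm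
  by_contra hcard
  push Not at hcard
  have hpos := Nat.choose_pos (Nat.succ_le_of_lt hcard)
  rw [← Multiset.card_powersetCard, Multiset.card_pos_iff_exists_mem] at hpos
  obtain ⟨t, ht'⟩ := hpos
  obtain ⟨ht, htc⟩ := Multiset.mem_powersetCard.1 ht'
  obtain ⟨x, y, v, rfl⟩ := Multiset.card_eq_three.1 htc
  have him : ∀ u ∈ ({x, y, v} : Multiset ℂ), u.im ≠ 0 := fun u hu =>
    (Multiset.mem_filter.1 (Multiset.mem_of_le ht hu)).2
  have hx := him x (by simp)
  have hy := him y (by simp)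
  have hv := him v (by simp)
  have hle := ht.trans (Multiset.filter_le _ _)
  have h1 := hpair x y hx hy (le_trans (Multiset.cons_le_cons x
    (Multiset.singleton_le.2 (by simp))) hle)
  have h2 := hpair x v hx hv (le_trans (Multiset.cons_le_cons x
    (Multiset.singleton_le.2 (by simp))) hle)
  have h3 := hpair y v hy hv (le_trans (Multiset.le_cons_self _ x) hle)
  rw [h1, Complex.conj_conj] at h3
  rw [h3] at h2
  exact hx (Complex.conj_eq_iff_im.1 h2.symm)
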